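/- arXiv:1402.6405 — 2 statements merged into one kernel-verified Lean document; each statement's English description precedes it below -/
import Mathlib

section
/- Let F be an infinite field with char F ≠ 2 and let n ≥ 1. Let a = (α_1, …, α_p), b = (β_1, …, β_q), c = (γ_1, …, γ_r) be sequences of positive integers with sums at most n. If max(α_1, β_1, γ_1) < n and the group F^×/(F^×)^2 is infinite, then the set of G-orbits on M_a × M_b × M_c under the diagonal action of G = O_{2n+1}(F) is infinite. -/
open Module

/-- The symmetric bilinear form on `F^N` given by `(e_i, e_j) = δ_{i, N+1-j}`
(in 1-indexed notation), i.e. `(u, v) = ∑ i, u i * v (rev i)`. -/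
def bform (F : Type*) [Field F] (N : ℕ) (u v : Fin N → F) : F :=
  ∑ i, u i * v i.rev

/-- `g` belongs to the split orthogonal group `O_N(F)`. -/
def IsOrthMap (F : Type*) [Field F] (N : ℕ)
    (g : (Fin N → F) ≃ₗ[F] (Fin N → F)) : Prop :=
  ∀ u v, bform F N (g u) (g v) = bform F N u v

/-- A subspace `V` is isotropic if `(V, V) = {0}`. -/
def IsIsotropic (F : Type*) [Field F] (N : ℕ) (V : Submodule F (Fin N → F)) : Prop :=
  ∀ u ∈ V, ∀ v ∈ V, bform F N u v = 0

/-- A flag of type `a = (a 0, …, a (p-1))` in `F^{2n+1}` : an increasing chain of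
subspaces `V 0 ⊆ ⋯ ⊆ V (p-1)` with `dim (V i) = a 0 + ⋯ + a i` which is isotropic
(equivalently, by monotonicity, whose top member is isotropic). -/
def IsFlag (F : Type*) [Field F] (n p : ℕ) (a : Fin p → ℕ)
    (V : Fin p → Submodule F (Fin (2*n+1) → F)) : Prop :=
  Monotone V ∧ (∀ i : Fin p, finrank F (V i) = ∑ j ∈ Finset.Iic i, a j) ∧
    ∀ i : Fin p, IsIsotropic F (2*n+1) (V i)

/-- The flag variety `M_a`. -/
def FlagVar (F : Type*) [Field F] (n p : ℕ) (a : Fin p → ℕ) :=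
  { V : Fin p → Submodule F (Fin (2*n+1) → F) // IsFlag F n p a V }

/-- The orbit relation of the diagonal action of `O_{2n+1}(F)` on the triple flag
variety `M_a × M_b × M_c`. -/
def TripleRel (F : Type*) [Field F] (n p q r : ℕ)
    (a : Fin p → ℕ) (b : Fin q → ℕ) (c : Fin r → ℕ)
    (x y : FlagVar F n p a × FlagVar F n q b × FlagVar F n r c) : Prop :=
  ∃ g : (Fin (2*n+1) → F) ≃ₗ[F] (Fin (2*n+1) → F), IsOrthMap F (2*n+1) g ∧
    (∀ i, Submodule.map g.toLinearMap (x.1.1 i) = y.1.1 i) ∧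
    (∀ i, Submodule.map g.toLinearMap (x.2.1.1 i) = y.2.1.1 i) ∧
    (∀ i, Submodule.map g.toLinearMap (x.2.2.1 i) = y.2.2.1 i)

section BForm

variable {F : Type*} [Field F] {N : ℕ}

theorem bform_add_left (x y z : Fin N → F) :
    bform F N (x + y) z = bform F N x z + bform F N y z := by
  simp [bform, add_mul, Finset.sum_add_distrib]

theorem bform_smul_left (c : F) (x z : Fin N → F) :
    bform F N (c • x) z = c * bform F N x z := by
  simp [bform, Finset.mul_sum, mul_assoc]

theorem bform_comm (x y : Fin N → F) : bform F N x y = bform F N y x := by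
  unfold bform
  rw [← Equiv.sum_comp Fin.revPerm]
  simp [mul_comm]

theorem bform_add_right (x y z : Fin N → F) :
    bform F N x (y + z) = bform F N x y + bform F N x z := by
  rw [bform_comm, bform_add_left, bform_comm y, bform_comm z]

theorem bform_smul_right (c : F) (x z : Fin N → F) :
    bform F N x (c • z) = c * bform F N x z := by
  rw [bform_comm, bform_smul_left, bform_comm z]

theorem bform_single_left (i : Fin N) (c : F) (v : Fin N → F) :
    bform F N (Pi.single i c) v = c * v i.rev := by
  simp [bform, Pi.single_apply]

theorem bform_eq_zero_of_mem_span_right {T : Set (Fin N → F)} {x : Fin N → F}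
    (h : ∀ y ∈ T, bform F N x y = 0) {y : Fin N → F} (hy : y ∈ Submodule.span F T) :
    bform F N x y = 0 := by
  induction hy using Submodule.span_induction with
  | mem y hy => exact h y hy
  | zero => simp [bform]
  | add y z _ _ hy hz => rw [bform_add_right, hy, hz, add_zero]
  | smul c y _ hy => rw [bform_smul_right, hy, mul_zero]

theorem bform_eq_zero_of_mem_span {S T : Set (Fin N → F)}
    (h : ∀ x ∈ S, ∀ y ∈ T, bform F N x y = 0) {x y : Fin N → F}
    (hx : x ∈ Submodule.span F S) (hy : y ∈ Submodule.span F T) : bform F N x y = 0 := by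
  rw [bform_comm]
  refine bform_eq_zero_of_mem_span_right (fun z hz => ?_) hx
  rw [bform_comm]
  exact bform_eq_zero_of_mem_span_right (h z hz) hy

/-- The form only sees the leading terms modulo a subspace spanned by `T` that is isotropic and
orthogonal to these terms. -/
theorem bform_smul_add_smul_add {T : Set (Fin N → F)} {u v z z' : Fin N → F} (c d : F)
    (hT : ∀ x ∈ T, ∀ y ∈ T, bform F N x y = 0) (hu : ∀ y ∈ T, bform F N u y = 0)
    (hv : ∀ y ∈ T, bform F N v y = 0) (hz : z ∈ Submodule.span F T)
    (hz' : z' ∈ Submodule.span F T) :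
    bform F N (c • u + z) (d • v + z') = c * d * bform F N u v := by
  have h1 : bform F N u z' = 0 := bform_eq_zero_of_mem_span_right hu hz'
  have h2 : bform F N z v = 0 := by
    rw [bform_comm]; exact bform_eq_zero_of_mem_span_right hv hz
  have h3 : bform F N z z' = 0 := bform_eq_zero_of_mem_span hT hz hz'
  simp only [bform_add_left, bform_add_right, bform_smul_left, bform_smul_right, h1, h2, h3]
  ring

end BForm

theorem tripleRel_equivalence (F : Type*) [Field F] (n p q r : ℕ)
    (a : Fin p → ℕ) (b : Fin q → ℕ) (c : Fin r → ℕ) :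
    Equivalence (TripleRel F n p q r a b c) where
  refl x := ⟨LinearEquiv.refl F _, fun _ _ => rfl, fun _ => Submodule.map_id _,
    fun _ => Submodule.map_id _, fun _ => Submodule.map_id _⟩
  symm := by
    rintro x y ⟨g, hg, h1, h2, h3⟩
    have key : ∀ V W : Submodule F (Fin (2 * n + 1) → F), V.map g.toLinearMap = W →
        W.map g.symm.toLinearMap = V := by
      rintro V _ rfl
      rw [← Submodule.map_comp]
      simp
    refine ⟨g.symm, fun u v => ?_, fun i => key _ _ (h1 i), fun i => key _ _ (h2 i),
      fun i => key _ _ (h3 i)⟩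
    rw [← hg]
    simp
  trans := by
    rintro x y z ⟨g, hg, h1, h2, h3⟩ ⟨g', hg', h1', h2', h3'⟩
    have key : ∀ U V W : Submodule F (Fin (2 * n + 1) → F), U.map g.toLinearMap = V →
        V.map g'.toLinearMap = W → U.map (g.trans g').toLinearMap = W := by
      rintro U _ _ rfl rfl
      rw [← Submodule.map_comp]
      rfl
    refine ⟨g.trans g', fun u v => ?_, fun i => key _ _ _ (h1 i) (h1' i),
      fun i => key _ _ _ (h2 i) (h2' i), fun i => key _ _ _ (h3 i) (h3' i)⟩
    simp [hg' _ _, hg _ _]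

/-- A basis of an isotropic subspace of dimension `n` yields flags of any type. -/
theorem exists_flagVar_eq_span {F : Type*} [Field F] {n p : ℕ} {a : Fin p → ℕ}
    (ha : ∑ i, a i ≤ n) {f : Fin n → Fin (2 * n + 1) → F} (hf : LinearIndependent F f)
    (hiso : ∀ j k, bform F (2 * n + 1) (f j) (f k) = 0) :
    ∃ V : FlagVar F n p a, ∀ i,
      V.1 i = Submodule.span F (f '' {k | k.val < ∑ j ∈ Finset.Iic i, a j}) := by
  refine ⟨⟨fun i => Submodule.span F (f '' {k | k.val < ∑ j ∈ Finset.Iic i, a j}),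
    fun i j hij => ?_, fun i => ?_, fun i u hu v hv => ?_⟩, fun i => rfl⟩
  · refine Submodule.span_mono (Set.image_mono fun k hk => Set.mem_ofPred.2 (hk.out.trans_le ?_))
    exact Finset.sum_le_sum_of_subset (Finset.Iic_subset_Iic.2 hij)
  · have hle : ∑ j ∈ Finset.Iic i, a j ≤ n :=
      (Finset.sum_le_sum_of_subset (Finset.subset_univ _)).trans ha
    have hr : f '' {k | k.val < ∑ j ∈ Finset.Iic i, a j} =
        Set.range (f ∘ Fin.castLE hle) := by
      rw [Set.range_comp]
      congr 1
      ext k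
      exact ⟨fun hk => ⟨⟨k, hk⟩, rfl⟩, by rintro ⟨l, rfl⟩; exact l.2⟩
    change finrank F (Submodule.span F (f '' _)) = _
    rw [hr, finrank_span_eq_card (hf.comp _ (Fin.castLE_injective hle)), Fintype.card_fin]
  · refine bform_eq_zero_of_mem_span ?_ hu hv
    rintro _ ⟨j, -, rfl⟩ _ ⟨k, -, rfl⟩
    exact hiso j k

section Frame

variable {F : Type*} [Field F] {m : ℕ}

/-- The standard basis vectors `e_1, …, e_m` in `F^{2(m+2)+1}`. -/
def initVec (F : Type*) [Field F] (m : ℕ) (k : Fin m) : Fin (2 * (m + 2) + 1) → F :=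
  Pi.single ⟨k, by omega⟩ 1

/-- The vector `u`, followed by `e_1, …, e_m` and `y`. -/
def frame (u y : Fin (2 * (m + 2) + 1) → F) : Fin (m + 2) → Fin (2 * (m + 2) + 1) → F :=
  Fin.cons u (Fin.snoc (initVec F m) y)

theorem bform_initVec_left (k : Fin m) (v : Fin (2 * (m + 2) + 1) → F) :
    bform F _ (initVec F m k) v = v ⟨2 * (m + 2) - k, by omega⟩ := by
  rw [initVec, bform_single_left, one_mul]
  congr 1
  ext
  simp only [Fin.val_rev]
  omega

theorem bform_initVec_initVec (j k : Fin m) :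
    bform F _ (initVec F m j) (initVec F m k) = 0 := by
  rw [bform_initVec_left, initVec, Pi.single_apply, if_neg]
  simp only [Fin.ext_iff]
  omega

theorem bform_frame_frame {u y : Fin (2 * (m + 2) + 1) → F}
    (huu : bform F _ u u = 0) (huy : bform F _ u y = 0) (hyy : bform F _ y y = 0)
    (hu : ∀ k, bform F _ u (initVec F m k) = 0) (hy : ∀ k, bform F _ y (initVec F m k) = 0)
    (j k : Fin (m + 2)) : bform F _ (frame u y j) (frame u y k) = 0 := by
  refine Fin.cases ?_ (fun j => ?_) j <;> refine Fin.cases ?_ (fun k => ?_) k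
  · simpa [frame] using huu
  · refine Fin.lastCases ?_ (fun k => ?_) k
    · simpa [frame] using huy
    · simpa [frame] using hu k
  · refine Fin.lastCases ?_ (fun j => ?_) j
    · rw [bform_comm]
      simpa [frame] using huy
    · rw [bform_comm]
      simpa [frame] using hu j
  · refine Fin.lastCases ?_ (fun j => ?_) j <;> refine Fin.lastCases ?_ (fun k => ?_) k
    · simpa [frame] using hyy
    · simpa [frame] using hy k
    · rw [bform_comm]
      simpa [frame] using hy j
    · simpa [frame] using bform_initVec_initVec j k

theorem linearIndependent_frame {u y : Fin (2 * (m + 2) + 1) → F}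
    (i j : Fin (2 * (m + 2) + 1)) (hi : m ≤ i.val) (hj : m ≤ j.val)
    (hui : u i = 1) (hyi : y i = 0) (hyj : y j = 1)
    (hu : ∀ k, k.val < m → u k = 0) (hy : ∀ k, k.val < m → y k = 0) :
    LinearIndependent F (frame u y) := by
  rw [Fintype.linearIndependent_iff]
  intro g hg
  have hsum : ∀ x, g 0 * u x + ((∑ k : Fin m, g k.castSucc.succ * initVec F m k x) +
      g (Fin.last m).succ * y x) = 0 := by
    intro x
    have := congrFun hg x
    simpa [Fin.sum_univ_succ, Fin.sum_univ_castSucc (n := m), frame, Finset.sum_apply,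
      -Fin.succ_last] using this
  have hbig : ∀ x : Fin (2 * (m + 2) + 1), m ≤ x.val → ∀ k : Fin m, initVec F m k x = 0 := by
    intro x hx k
    rw [initVec, Pi.single_apply, if_neg]
    simp only [Fin.ext_iff]
    omega
  have h0 : g 0 = 0 := by simpa [hui, hyi, hbig i hi] using hsum i
  have h1 : g (Fin.last m).succ = 0 := by simpa [h0, hyj, hbig j hj] using hsum j
  refine Fin.cases h0 (Fin.lastCases h1 fun k => ?_)
  have := hsum ⟨k, by omega⟩
  simpa [h0, h1, hu, hy, initVec, Pi.single_apply, Fin.val_inj, -Fin.succ_last] using this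

theorem exists_smul_add_of_mem_span_frame {u y x : Fin (2 * (m + 2) + 1) → F} {d : ℕ}
    (hd : d < m + 2) (hx : x ∈ Submodule.span F (frame u y '' {k | k.val < d})) :
    ∃ s : F, ∃ z ∈ Submodule.span F (Set.range (initVec F m)), x = s • u + z := by
  have hle : Submodule.span F (frame u y '' {k | k.val < d}) ≤
      Submodule.span F {u} ⊔ Submodule.span F (Set.range (initVec F m)) := by
    rw [Submodule.span_le]
    rintro _ ⟨k, hk, rfl⟩
    revert hk
    refine Fin.cases (fun _ => ?_) (Fin.lastCases (fun hk => ?_) fun k _ => ?_) k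
    · exact Submodule.mem_sup_left (Submodule.subset_span rfl)
    · simp at hk
      omega
    · refine Submodule.mem_sup_right (Submodule.subset_span ⟨k, ?_⟩)
      simp [frame]
  obtain ⟨y', hy', z, hz, rfl⟩ := Submodule.mem_sup.1 (hle hx)
  obtain ⟨s, rfl⟩ := Submodule.mem_span_singleton.1 hy'
  exact ⟨s, z, hz, rfl⟩

/-- There is a flag whose first member is spanned by `u` and some of the vectors
`e_1, …, e_m`. -/
theorem exists_flagVar_of_frame {p : ℕ} (hp : 0 < p) {a : Fin p → ℕ}
    (ha0 : 0 < a ⟨0, hp⟩) (ha : ∑ i, a i ≤ m + 2) (ham : a ⟨0, hp⟩ < m + 2)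
    {u y : Fin (2 * (m + 2) + 1) → F} (hf : LinearIndependent F (frame u y))
    (hiso : ∀ j k, bform F _ (frame u y j) (frame u y k) = 0) :
    ∃ V : FlagVar F (m + 2) p a, u ∈ V.1 ⟨0, hp⟩ ∧ ∀ x ∈ V.1 ⟨0, hp⟩,
      ∃ s : F, ∃ z ∈ Submodule.span F (Set.range (initVec F m)), x = s • u + z := by
  obtain ⟨V, hV⟩ := exists_flagVar_eq_span ha hf hiso
  have h0 : ∑ j ∈ Finset.Iic (⟨0, hp⟩ : Fin p), a j = a ⟨0, hp⟩ := by
    have : Finset.Iic (⟨0, hp⟩ : Fin p) = {⟨0, hp⟩} := by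
      ext j
      simp [Fin.le_def, Fin.ext_iff]
    rw [this, Finset.sum_singleton]
  refine ⟨V, ?_, fun x hx => ?_⟩
  · rw [hV, h0]
    exact Submodule.subset_span ⟨0, by simpa using ha0, by simp [frame]⟩
  · rw [hV, h0] at hx
    exact exists_smul_add_of_mem_span_frame ham hx

end Frame

section Vectors

variable (F : Type*) [Field F] (m : ℕ)

/-- The standard basis vector `e_{m+k+1}` of `F^{2(m+2)+1}`, for `k ≤ 4`: these span the
orthogonal complement of the hyperbolic space on `e_1, …, e_m`. -/
def midVec (k : Fin 5) : Fin (2 * (m + 2) + 1) → F :=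
  Pi.single ⟨m + k, by omega⟩ 1

variable {F m}

theorem midVec_apply (k : Fin 5) (i : Fin (2 * (m + 2) + 1)) :
    midVec F m k i = if i.val = m + k then 1 else 0 := by
  simp [midVec, Pi.single_apply, Fin.ext_iff]

theorem bform_midVec_left (k : Fin 5) (v : Fin (2 * (m + 2) + 1) → F) :
    bform F _ (midVec F m k) v = v ⟨m + k.rev, by omega⟩ := by
  rw [midVec, bform_single_left, one_mul]
  congr 1
  ext
  simp only [Fin.val_rev]
  omega

theorem bform_midVec_midVec (j k : Fin 5) :
    bform F _ (midVec F m j) (midVec F m k) = if j.rev = k then 1 else 0 := by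
  simp [bform_midVec_left, midVec_apply, Fin.ext_iff]

theorem bform_midVec_initVec (j : Fin 5) (k : Fin m) :
    bform F _ (midVec F m j) (initVec F m k) = 0 := by
  rw [bform_comm, bform_initVec_left, midVec_apply, if_neg]
  simp only
  omega

theorem midVec_apply_of_lt (k : Fin 5) {i : Fin (2 * (m + 2) + 1)} (hi : i.val < m) :
    midVec F m k i = 0 := by
  rw [midVec_apply, if_neg]
  omega

/-- An isotropic vector pairing to `1` with `e_{m+2}` and to `t` with `e_{m+4}`. -/
def thirdVec (m : ℕ) (t : F) : Fin (2 * (m + 2) + 1) → F :=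
  t • midVec F m 1 + midVec F m 3 + midVec F m 0 + (-t) • midVec F m 4

theorem bform_thirdVec_initVec (t : F) (k : Fin m) :
    bform F _ (thirdVec m t) (initVec F m k) = 0 := by
  simp [thirdVec, bform_add_left, bform_smul_left, bform_midVec_initVec, -neg_smul]

theorem bform_midVec_one_midVec_three :
    bform F _ (midVec F m 1) (midVec F m 3) = 1 := by
  rw [bform_midVec_midVec, if_pos (by decide)]

theorem bform_midVec_one_thirdVec (t : F) :
    bform F _ (midVec F m 1) (thirdVec m t) = 1 := by
  simp [thirdVec, bform_midVec_left, midVec_apply]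

theorem bform_midVec_three_thirdVec (t : F) :
    bform F _ (midVec F m 3) (thirdVec m t) = t := by
  simp [thirdVec, bform_midVec_left, midVec_apply]

variable {p : ℕ} (hp : 0 < p) {a : Fin p → ℕ}

theorem exists_flagVar_midVec (j : Fin 5) (hj : j = 1 ∨ j = 3)
    (ha0 : 0 < a ⟨0, hp⟩) (ha : ∑ i, a i ≤ m + 2) (ham : a ⟨0, hp⟩ < m + 2) :
    ∃ V : FlagVar F (m + 2) p a, midVec F m j ∈ V.1 ⟨0, hp⟩ ∧ ∀ x ∈ V.1 ⟨0, hp⟩,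
      ∃ s : F, ∃ z ∈ Submodule.span F (Set.range (initVec F m)), x = s • midVec F m j + z := by
  refine exists_flagVar_of_frame hp ha0 ha ham (y := midVec F m 0)
    (linearIndependent_frame ⟨m + j, by omega⟩ ⟨m, by omega⟩ (by simp) le_rfl
      ?_ ?_ ?_ (fun _ => midVec_apply_of_lt _) (fun _ => midVec_apply_of_lt _))
    (bform_frame_frame ?_ ?_ ?_ (bform_midVec_initVec _) (bform_midVec_initVec _))
  all_goals rcases hj with rfl | rfl <;> simp [bform_midVec_midVec, midVec_apply, Fin.ext_iff]

theorem exists_flagVar_thirdVec {t : F} (ha0 : 0 < a ⟨0, hp⟩)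
    (ha : ∑ i, a i ≤ m + 2) (ham : a ⟨0, hp⟩ < m + 2) :
    ∃ V : FlagVar F (m + 2) p a, thirdVec m t ∈ V.1 ⟨0, hp⟩ ∧ ∀ x ∈ V.1 ⟨0, hp⟩,
      ∃ s : F, ∃ z ∈ Submodule.span F (Set.range (initVec F m)), x = s • thirdVec m t + z := by
  refine exists_flagVar_of_frame hp ha0 ha ham (y := t • midVec F m 1 + midVec F m 0)
    (linearIndependent_frame ⟨m + 3, by omega⟩ ⟨m, by omega⟩ (by simp) le_rfl
      ?_ ?_ ?_ (fun k hk => ?_) (fun k hk => ?_))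
    (bform_frame_frame ?_ ?_ ?_ (bform_thirdVec_initVec _) (fun k => ?_))
  · simp [thirdVec, midVec_apply]
  · simp [midVec_apply]
  · simp [midVec_apply]
  · simp [thirdVec, midVec_apply_of_lt _ hk]
  · simp [midVec_apply_of_lt _ hk]
  · simp [thirdVec, bform_add_left, bform_smul_left, bform_midVec_left, midVec_apply, -neg_smul]
  · simp [thirdVec, bform_add_left, bform_smul_left, bform_midVec_left, midVec_apply, -neg_smul]
  · simp [bform_add_left, bform_smul_left, bform_midVec_left, midVec_apply]
  · simp [bform_add_left, bform_smul_left, bform_midVec_initVec]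

end Vectors

/-- if `max(α_1, β_1, γ_1) < n` and `F^×/(F^×)^2` is infinite, then
`M_a × M_b × M_c` has infinitely many `O_{2n+1}(F)`-orbits. -/
theorem statement2 (F : Type*) [Field F] [Infinite F] (hchar : (2 : F) ≠ 0)
    (n : ℕ) (hn : 1 ≤ n) (p q r : ℕ) (hp : 0 < p) (hq : 0 < q) (hr : 0 < r)
    (a : Fin p → ℕ) (b : Fin q → ℕ) (c : Fin r → ℕ)
    (hapos : ∀ i, 0 < a i) (hbpos : ∀ i, 0 < b i) (hcpos : ∀ i, 0 < c i)
    (hasum : (∑ i, a i) ≤ n) (hbsum : (∑ i, b i) ≤ n) (hcsum : (∑ i, c i) ≤ n)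
    (hmax : max (a ⟨0, hp⟩) (max (b ⟨0, hq⟩) (c ⟨0, hr⟩)) < n)
    (hsq : Infinite (Fˣ ⧸ (powMonoidHom 2 : Fˣ →* Fˣ).range)) :
    Infinite (Quot (TripleRel F n p q r a b c)) := by
  obtain ⟨ha, hb, hc⟩ : a ⟨0, hp⟩ < n ∧ b ⟨0, hq⟩ < n ∧ c ⟨0, hr⟩ < n := by
    simpa only [max_lt_iff] using hmax
  have ha0 := hapos ⟨0, hp⟩
  have hb0 := hbpos ⟨0, hq⟩
  have hc0 := hcpos ⟨0, hr⟩
  obtain ⟨m, rfl⟩ : ∃ m, n = m + 2 := ⟨n - 2, by omega⟩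
  obtain ⟨A, hAu, hA⟩ := exists_flagVar_midVec (F := F) hp 1 (.inl rfl) ha0 hasum ha
  obtain ⟨B, hBv, hB⟩ := exists_flagVar_midVec (F := F) hq 3 (.inr rfl) hb0 hbsum hb
  choose C hCw hC using fun t : F => exists_flagVar_thirdVec (t := t) hr hc0 hcsum hc
  have key : ∀ t s : Fˣ, TripleRel F (m + 2) p q r a b c (A, B, C t) (A, B, C s) →
      ∃ d : Fˣ, d ^ 2 = t⁻¹ * s := by
    rintro t s ⟨g, hg, h1, h2, h3⟩
    obtain ⟨c₁, z₁, hz₁, e₁⟩ := hA _ (h1 ⟨0, hp⟩ ▸ Submodule.mem_map_of_mem hAu)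
    obtain ⟨c₂, z₂, hz₂, e₂⟩ := hB _ (h2 ⟨0, hq⟩ ▸ Submodule.mem_map_of_mem hBv)
    obtain ⟨c₃, z₃, hz₃, e₃⟩ := hC s _ (h3 ⟨0, hr⟩ ▸ Submodule.mem_map_of_mem (hCw t))
    have hT : ∀ x ∈ Set.range (initVec F m), ∀ y ∈ Set.range (initVec F m),
        bform F _ x y = 0 := by
      rintro _ ⟨j, rfl⟩ _ ⟨k, rfl⟩
      exact bform_initVec_initVec j k
    have hu : ∀ y ∈ Set.range (initVec F m), bform F _ (midVec F m 1) y = 0 :=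
      Set.forall_mem_range.2 (bform_midVec_initVec 1)
    have hv : ∀ y ∈ Set.range (initVec F m), bform F _ (midVec F m 3) y = 0 :=
      Set.forall_mem_range.2 (bform_midVec_initVec 3)
    have hw : ∀ y ∈ Set.range (initVec F m), bform F _ (thirdVec m (s : F)) y = 0 :=
      Set.forall_mem_range.2 (bform_thirdVec_initVec _)
    simp only [LinearEquiv.coe_coe] at e₁ e₂ e₃
    have h12 := hg (midVec F m 1) (midVec F m 3)
    have h13 := hg (midVec F m 1) (thirdVec m (t : F))
    have h23 := hg (midVec F m 3) (thirdVec m (t : F))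
    rw [e₁, e₂, bform_smul_add_smul_add _ _ hT hu hv hz₁ hz₂,
      bform_midVec_one_midVec_three, mul_one] at h12
    rw [e₁, e₃, bform_smul_add_smul_add _ _ hT hu hw hz₁ hz₃,
      bform_midVec_one_thirdVec, bform_midVec_one_thirdVec, mul_one] at h13
    rw [e₂, e₃, bform_smul_add_smul_add _ _ hT hv hw hz₂ hz₃,
      bform_midVec_three_thirdVec, bform_midVec_three_thirdVec] at h23
    refine ⟨Units.mk0 c₁ (left_ne_zero_of_mul_eq_one h12), ?_⟩
    rw [eq_inv_mul_iff_mul_eq]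
    ext
    push_cast
    rw [Units.val_mk0]
    linear_combination (-c₁ ^ 2) * h23 + c₁ * c₃ * s * h12 + s * h13
  refine Infinite.of_injective (fun x : Fˣ ⧸ (powMonoidHom 2 : Fˣ →* Fˣ).range =>
    Quot.mk (TripleRel F (m + 2) p q r a b c) (A, B, C (x.out : Fˣ))) fun x y hxy => ?_
  have hrel := (tripleRel_equivalence F (m + 2) p q r a b c).eqvGen_iff.1 (Quot.eqvGen_exact hxy)
  obtain ⟨d, hd⟩ := key _ _ hrel
  rw [← QuotientGroup.out_eq' x, ← QuotientGroup.out_eq' y]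
  exact QuotientGroup.eq.2 ⟨d, hd⟩
end

section
/- Let F be an infinite field with char F ≠ 2, and take n = 2, so G = O_5(F). Then both triple flag varieties M_{(2)} × M_{(1,1)} × M_{(1,1)} and M_{(1)} × M_{(1,1)} × M_{(1,1)} have infinitely many G-orbits under the diagonal action. -/
open Module

/-- A quotient is infinite as soon as some infinite family meets every class finitely often. -/
theorem infinite_quot_of_finite_fibers {X S : Type*} [Infinite S] {r : X → X → Prop}
    (hr : Equivalence r) (x : S → X) (h : ∀ s, {t | r (x s) (x t)}.Finite) :
    Infinite (Quot r) := by
  by_contra hfin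
  rw [not_infinite_iff_finite] at hfin
  obtain ⟨y, hy⟩ := Finite.exists_infinite_fiber fun s => Quot.mk r (x s)
  obtain ⟨s, hs⟩ := hy.nonempty
  refine (Set.infinite_coe_iff.mp hy) ((h s).subset fun t ht => ?_)
  have hst : Quot.mk r (x s) = Quot.mk r (x t) := hs.trans (Eq.symm ht)
  exact hr.eqvGen_iff.mp (Quot.eqvGen_exact hst)

section Five

variable {F : Type*} [Field F]

theorem bform_five (u v : Fin 5 → F) :
    bform F 5 u v = u 0 * v 4 + u 1 * v 3 + u 2 * v 2 + u 3 * v 1 + u 4 * v 0 := by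
  simp only [bform, Fin.sum_univ_five]
  rfl

theorem isIsotropic_span_singleton {N : ℕ} {a : Fin N → F} (ha : bform F N a a = 0) :
    IsIsotropic F N (Submodule.span F {a}) := by
  intro u hu v hv
  obtain ⟨x, rfl⟩ := Submodule.mem_span_singleton.mp hu
  obtain ⟨y, rfl⟩ := Submodule.mem_span_singleton.mp hv
  have : bform F N (x • a) (y • a) = x * y * bform F N a a := by
    simp only [bform, Pi.smul_apply, smul_eq_mul, Finset.mul_sum]
    exact Finset.sum_congr rfl fun _ _ => by ring
  rw [this, ha, mul_zero]

theorem isIsotropic_span_pair {a b : Fin 5 → F} (ha : bform F 5 a a = 0)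
    (hb : bform F 5 b b = 0) (hab : bform F 5 a b = 0) :
    IsIsotropic F 5 (Submodule.span F {a, b}) := by
  intro u hu v hv
  obtain ⟨x, y, rfl⟩ := Submodule.mem_span_pair.mp hu
  obtain ⟨z, w, rfl⟩ := Submodule.mem_span_pair.mp hv
  rw [bform_five] at *
  simp only [Pi.add_apply, Pi.smul_apply, smul_eq_mul]
  linear_combination x * z * ha + y * w * hb + (x * w + y * z) * hab

theorem finrank_span_pair {V : Type*} [AddCommGroup V] [Module F V] {a b : V}
    (h : LinearIndependent F ![a, b]) : finrank F (Submodule.span F {a, b}) = 2 := by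
  have hrange : Set.range ![a, b] = {a, b} := by simp [Matrix.range_cons, Set.pair_comm]
  rw [← hrange, finrank_span_eq_card h, Fintype.card_fin]

/-- The isotropic line spanned by `a`, as a flag of type `(1)`. -/
def lineFlag (a : Fin 5 → F) (h : a ≠ 0) (ha : bform F 5 a a = 0) : FlagVar F 2 1 ![1] :=
  ⟨fun _ => Submodule.span F {a}, fun _ _ _ => le_rfl,
    fun i => by rw [finrank_span_singleton h]; fin_cases i; rfl,
    fun _ => isIsotropic_span_singleton ha⟩

/-- The isotropic plane spanned by `a` and `b`, as a flag of type `(2)`. -/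
def planeFlag (a b : Fin 5 → F) (h : LinearIndependent F ![a, b]) (ha : bform F 5 a a = 0)
    (hb : bform F 5 b b = 0) (hab : bform F 5 a b = 0) : FlagVar F 2 1 ![2] :=
  ⟨fun _ => Submodule.span F {a, b}, fun _ _ _ => le_rfl,
    fun i => by rw [finrank_span_pair h]; fin_cases i; rfl,
    fun _ => isIsotropic_span_pair ha hb hab⟩

/-- The full isotropic flag `⟨a⟩ ⊆ ⟨a, b⟩`. -/
def fullFlag (a b : Fin 5 → F) (h : LinearIndependent F ![a, b]) (ha : bform F 5 a a = 0)
    (hb : bform F 5 b b = 0) (hab : bform F 5 a b = 0) : FlagVar F 2 2 ![1, 1] :=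
  ⟨![Submodule.span F {a}, Submodule.span F {a, b}], by
    have hle : Submodule.span F {a} ≤ Submodule.span F {a, b} :=
      Submodule.span_mono (by simp)
    refine ⟨?_, ?_, ?_⟩
    · intro i j hij
      fin_cases i <;> fin_cases j
      · exact le_rfl
      · exact hle
      · simp at hij
      · exact le_rfl
    · intro i
      fin_cases i
      · exact finrank_span_singleton (h.ne_zero 0)
      · exact finrank_span_pair h
    · intro i
      fin_cases i
      · exact isIsotropic_span_singleton ha
      · exact isIsotropic_span_pair ha hb hab⟩

/-- The flag `⟨e₁⟩ ⊆ ⟨e₁, e₂⟩`. -/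
def stdFlag (F : Type*) [Field F] : FlagVar F 2 2 ![1, 1] :=
  fullFlag ![1, 0, 0, 0, 0] ![0, 1, 0, 0, 0]
    (LinearIndependent.pair_iff.mpr fun s t h =>
      ⟨by simpa using congrFun h 0, by simpa using congrFun h 1⟩)
    (by simp [bform_five]) (by simp [bform_five]) (by simp [bform_five])

/-- The flag `⟨e₅⟩ ⊆ ⟨e₅, e₄⟩`, opposite to `stdFlag`. -/
def oppFlag (F : Type*) [Field F] : FlagVar F 2 2 ![1, 1] :=
  fullFlag ![0, 0, 0, 0, 1] ![0, 0, 0, 1, 0]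
    (LinearIndependent.pair_iff.mpr fun s t h =>
      ⟨by simpa using congrFun h 4, by simpa using congrFun h 3⟩)
    (by simp [bform_five]) (by simp [bform_five]) (by simp [bform_five])

/-- An orthogonal map stabilizing two opposite full flags acts diagonally, up to the middle
coordinate. -/
theorem exists_diagonal_of_map_flags {g : (Fin 5 → F) ≃ₗ[F] (Fin 5 → F)}
    (hg : IsOrthMap F 5 g)
    (hs : ∀ i, ((stdFlag F).1 i).map g.toLinearMap = (stdFlag F).1 i)
    (ho : ∀ i, ((oppFlag F).1 i).map g.toLinearMap = (oppFlag F).1 i) :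
    ∃ α β γ δ : F, α * δ = 1 ∧ β * γ = 1 ∧
      ∀ v, α * g v 4 = v 4 ∧ δ * g v 0 = v 0 ∧ β * g v 3 = v 3 ∧ γ * g v 1 = v 1 := by
  have m₁ : g ![1, 0, 0, 0, 0] ∈ Submodule.span F {![1, 0, 0, 0, 0]} := by
    have := Submodule.mem_map_of_mem (f := g.toLinearMap)
      (Submodule.mem_span_singleton_self (R := F) (![1, 0, 0, 0, 0] : Fin 5 → F))
    exact (hs 0).le this
  have m₅ : g ![0, 0, 0, 0, 1] ∈ Submodule.span F {![0, 0, 0, 0, 1]} := by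
    have := Submodule.mem_map_of_mem (f := g.toLinearMap)
      (Submodule.mem_span_singleton_self (R := F) (![0, 0, 0, 0, 1] : Fin 5 → F))
    exact (ho 0).le this
  have m₂ : g ![0, 1, 0, 0, 0] ∈ Submodule.span F {![1, 0, 0, 0, 0], ![0, 1, 0, 0, 0]} :=
    (hs 1).le (Submodule.mem_map_of_mem (f := g.toLinearMap)
      (Submodule.subset_span (by simp)))
  have m₄ : g ![0, 0, 0, 1, 0] ∈ Submodule.span F {![0, 0, 0, 0, 1], ![0, 0, 0, 1, 0]} :=
    (ho 1).le (Submodule.mem_map_of_mem (f := g.toLinearMap)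
      (Submodule.subset_span (by simp)))
  obtain ⟨α, h₁⟩ := Submodule.mem_span_singleton.mp m₁
  obtain ⟨δ, h₅⟩ := Submodule.mem_span_singleton.mp m₅
  obtain ⟨β', β, h₂⟩ := Submodule.mem_span_pair.mp m₂
  obtain ⟨γ', γ, h₄⟩ := Submodule.mem_span_pair.mp m₄
  have h₁₅ : α * δ = 1 := by
    simpa [bform_five, ← h₁, ← h₅] using hg ![1, 0, 0, 0, 0] ![0, 0, 0, 0, 1]
  have hα : α ≠ 0 := left_ne_zero_of_mul_eq_one h₁₅
  have hδ : δ ≠ 0 := right_ne_zero_of_mul_eq_one h₁₅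
  have hβ' : β' = 0 := by
    simpa [bform_five, ← h₂, ← h₅, hδ] using hg ![0, 1, 0, 0, 0] ![0, 0, 0, 0, 1]
  have hγ' : γ' = 0 := by
    simpa [bform_five, ← h₁, ← h₄, hα] using hg ![1, 0, 0, 0, 0] ![0, 0, 0, 1, 0]
  subst hβ' hγ'
  refine ⟨α, β, γ, δ, h₁₅, ?_, fun v => ⟨?_, ?_, ?_, ?_⟩⟩
  · simpa [bform_five, ← h₂, ← h₄] using hg ![0, 1, 0, 0, 0] ![0, 0, 0, 1, 0]
  · simpa [bform_five, ← h₁] using hg ![1, 0, 0, 0, 0] v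
  · simpa [bform_five, ← h₅] using hg ![0, 0, 0, 0, 1] v
  · simpa [bform_five, ← h₂] using hg ![0, 1, 0, 0, 0] v
  · simpa [bform_five, ← h₄] using hg ![0, 0, 0, 1, 0] v

theorem infinite_quot_plane_full_full [Infinite F] (hchar : (2 : F) ≠ 0) :
    Infinite (Quot (TripleRel F 2 1 2 2 ![2] ![1, 1] ![1, 1])) := by
  have : Infinite {s : F // s ≠ 1} := (Set.finite_singleton (1 : F)).infinite_compl.to_subtype
  refine infinite_quot_of_finite_fibers (tripleRel_equivalence F 2 1 2 2 _ _ _)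
    (fun s : {s : F // s ≠ 1} =>
      (planeFlag ![1, 2, 2, -1, 0] ![0, 2, 2 * s.1, -s.1 ^ 2, 2 * (s.1 - 1) ^ 2]
        (LinearIndependent.pair_iff.mpr fun x y h => by
          have hx : x = 0 := by simpa using congrFun h 0
          have hy := congrFun h 1
          exact ⟨hx, by simpa [hx, hchar] using hy⟩)
        (by simp [bform_five]; ring) (by simp [bform_five]; ring)
        (by simp [bform_five]; ring), stdFlag F, oppFlag F)) fun s => ?_
  have hfin : {t : F | t = s.1 ∨ t = -s.1}.Finite :=
    (Set.finite_singleton (-s.1)).insert s.1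
  refine (hfin.preimage Subtype.val_injective.injOn).subset ?_
  rintro ⟨t, ht⟩ ⟨g, hg, hU, hs, ho⟩
  obtain ⟨α, β, γ, δ, hαδ, hβγ, hd⟩ := exists_diagonal_of_map_flags hg hs ho
  have ha := (hU 0).le (Submodule.mem_map_of_mem (f := g.toLinearMap)
    (Submodule.subset_span (Set.mem_insert _ _)))
  have hb := (hU 0).le (Submodule.mem_map_of_mem (f := g.toLinearMap)
    (Submodule.subset_span (Set.mem_insert_of_mem _ rfl)))
  obtain ⟨x, y, hxy⟩ := Submodule.mem_span_pair.mp ha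
  obtain ⟨z, w, hzw⟩ := Submodule.mem_span_pair.mp hb
  obtain ⟨a₄, a₀, a₃, a₁⟩ := hd ![1, 2, 2, -1, 0]
  obtain ⟨b₄, b₀, b₃, b₁⟩ := hd ![0, 2, 2 * s.1, -s.1 ^ 2, 2 * (s.1 - 1) ^ 2]
  rw [LinearEquiv.coe_coe] at hxy hzw
  simp only [← hxy, ← hzw, Pi.add_apply, Pi.smul_apply, smul_eq_mul, Matrix.cons_val,
    mul_zero, add_zero, mul_one, zero_add] at a₄ a₁ a₃ b₀ b₁ b₃
  have hα : α ≠ 0 := left_ne_zero_of_mul_eq_one hαδ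
  have hδ : δ ≠ 0 := right_ne_zero_of_mul_eq_one hαδ
  have hy : y = 0 := by simpa [hα, hchar, sub_ne_zero.mpr ht] using a₄
  have hz : z = 0 := by simpa [hδ] using b₀
  subst hy hz
  have hx : x = β := mul_left_cancel₀ hchar (by linear_combination β * a₁ - 2 * x * hβγ)
  have hw : w = β := mul_left_cancel₀ hchar (by linear_combination β * b₁ - 2 * w * hβγ)
  subst hx hw
  have hts : t ^ 2 = s.1 ^ 2 := by linear_combination t ^ 2 * a₃ - b₃
  exact sq_eq_sq_iff_eq_or_eq_neg.mp hts

theorem infinite_quot_line_full_full [Infinite F] (hchar : (2 : F) ≠ 0) :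
    Infinite (Quot (TripleRel F 2 1 2 2 ![1] ![1, 1] ![1, 1])) := by
  refine infinite_quot_of_finite_fibers (tripleRel_equivalence F 2 1 2 2 _ _ _)
    (fun s : F =>
      (lineFlag ![1, 1, 2, -(s + 2), s] (fun h => one_ne_zero (congrFun h 0))
        (by simp [bform_five]; ring), stdFlag F, oppFlag F)) fun s => ?_
  refine (Set.finite_singleton s).subset ?_
  rintro t ⟨g, hg, hU, hs, ho⟩
  obtain ⟨α, β, γ, δ, hαδ, hβγ, hd⟩ := exists_diagonal_of_map_flags hg hs ho
  have hu := (hU 0).le (Submodule.mem_map_of_mem (f := g.toLinearMap)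
    (Submodule.mem_span_singleton_self _))
  obtain ⟨c, hc⟩ := Submodule.mem_span_singleton.mp hu
  obtain ⟨u₄, u₀, u₃, u₁⟩ := hd ![1, 1, 2, -(s + 2), s]
  rw [LinearEquiv.coe_coe] at hc
  simp only [← hc, Pi.smul_apply, smul_eq_mul, Matrix.cons_val, mul_one] at u₄ u₀ u₃ u₁
  have hcα : c = α := by linear_combination α * u₀ - c * hαδ
  have hcβ : c = β := by linear_combination β * u₁ - c * hβγ
  subst hcα hcβ
  have hsq : c * c = 1 := mul_left_cancel₀ hchar (by linear_combination -u₃ - u₄)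
  change t = s
  linear_combination u₄ - t * hsq

end Five

/-- for `n = 2` (so `G = O_5(F)`), the triple flag varieties
`M_{(2)} × M_{(1,1)} × M_{(1,1)}` and `M_{(1)} × M_{(1,1)} × M_{(1,1)}` both have
infinitely many `G`-orbits under the diagonal action. -/
theorem statement8 (F : Type*) [Field F] [Infinite F] (hchar : (2 : F) ≠ 0) :
    Infinite (Quot (TripleRel F 2 1 2 2 ![2] ![1, 1] ![1, 1])) ∧
      Infinite (Quot (TripleRel F 2 1 2 2 ![1] ![1, 1] ![1, 1])) :=
  ⟨infinite_quot_plane_full_full hchar, infinite_quot_line_full_full hchar⟩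
end
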